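/- arXiv:1602.05608 — 3 statements merged into one kernel-verified Lean document; each statement's English description precedes it below -/
import Mathlib

section
/- Let G = (V, E) be a graph and S a set of unordered pairs of vertices, each pair at distance exactly 2 in G. The number of 2-edge-colorings of G that satisfy every pair in S (i.e., connect each pair in S by a rainbow 2-edge path) equals Σ_{X ⊆ S} (−1)^{|X|} · 2^{|E / ≈_X|}, where ≈_X is the equivalence relation on E generated by linking any two edges lying on length-2 paths (with endpoints in X) that share an edge. -/
/-- The set `P_X` of length-2 paths of `G` whose endpoints form a pair in `X`;
a path is recorded as a triple `(u, x, v)` with `{u,v} ∈ X`, `u ~ x`, `x ~ v`. -/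
def twoPathsIn {V : Type*} (G : SimpleGraph V) (X : Set (Sym2 V)) : Set (V × V × V) :=
  {p | s(p.1, p.2.2) ∈ X ∧ G.Adj p.1 p.2.1 ∧ G.Adj p.2.1 p.2.2}

/-- The two edges of a length-2 path `(u, x, v)`. -/
def pathEdges {V : Type*} (p : V × V × V) : Set (Sym2 V) :=
  {s(p.1, p.2.1), s(p.2.1, p.2.2)}

/-- `e₁ ~_X e₂`: there are paths `P₁, P₂ ∈ P_X` with `e₁ ∈ E(P₁)`, `e₂ ∈ E(P₂)` and
`E(P₁) ∩ E(P₂) ≠ ∅`.  The relation `≈_X` is its equivalence closure. -/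
def linkedBy {V : Type*} (G : SimpleGraph V) (X : Set (Sym2 V))
    (e₁ e₂ : G.edgeSet) : Prop :=
  ∃ P₁ ∈ twoPathsIn G X, ∃ P₂ ∈ twoPathsIn G X,
    (e₁ : Sym2 V) ∈ pathEdges P₁ ∧ (e₂ : Sym2 V) ∈ pathEdges P₂ ∧
      (pathEdges P₁ ∩ pathEdges P₂).Nonempty

/-- The pair `e = {u,v}` is satisfied by the 2-edge-coloring `c`: some length-2 path
from `u` to `v` has its two edges colored differently (a rainbow length-2 path). -/
def satisfiedBy {V : Type*} (G : SimpleGraph V) (c : G.edgeSet → Fin 2)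
    (e : Sym2 V) : Prop :=
  ∃ u v x : V, e = s(u, v) ∧ ∃ (h1 : G.Adj u x) (h2 : G.Adj x v),
    c ⟨s(u, x), G.mem_edgeSet.mpr h1⟩ ≠ c ⟨s(x, v), G.mem_edgeSet.mpr h2⟩

theorem unsat_iff {V : Type*} (G : SimpleGraph V) (X : Set (Sym2 V))
    (c : G.edgeSet → Fin 2) :
    (∀ e ∈ X, ¬ satisfiedBy G c e) ↔ ∀ e₁ e₂, linkedBy G X e₁ e₂ → c e₁ = c e₂ := by
  constructor
  · intro h
    have mono : ∀ P ∈ twoPathsIn G X, ∀ a b : G.edgeSet, (a : Sym2 V) ∈ pathEdges P →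
        (b : Sym2 V) ∈ pathEdges P → c a = c b := by
      rintro ⟨u, x, v⟩ ⟨hP, h1, h2⟩ ⟨a, ha⟩ ⟨b, hb⟩ haP hbP
      have hc : c ⟨s(u, x), G.mem_edgeSet.mpr h1⟩ = c ⟨s(x, v), G.mem_edgeSet.mpr h2⟩ := by
        by_contra hne
        exact h _ hP ⟨u, v, x, rfl, h1, h2, hne⟩
      simp only [pathEdges, Set.mem_insert_iff, Set.mem_singleton_iff] at haP hbP
      rcases haP with rfl | rfl <;> rcases hbP with rfl | rfl
      · rfl
      · exact hc
      · exact hc.symm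
      · rfl
    rintro e₁ e₂ ⟨P₁, h1, P₂, h2, he1, he2, f, hf1, hf2⟩
    have hf : f ∈ G.edgeSet := by
      obtain ⟨_, ha, hb⟩ := h1
      simp only [pathEdges, Set.mem_insert_iff, Set.mem_singleton_iff] at hf1
      rcases hf1 with rfl | rfl
      · exact ha
      · exact hb
    exact (mono P₁ h1 e₁ ⟨f, hf⟩ he1 hf1).trans (mono P₂ h2 ⟨f, hf⟩ e₂ hf2 he2)
  · rintro h e he ⟨u, v, x, rfl, h1, h2, hne⟩
    apply hne
    apply h
    refine ⟨(u, x, v), ⟨he, h1, h2⟩, (u, x, v), ⟨he, h1, h2⟩, ?_, ?_, ?_⟩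
    · simp [pathEdges]
    · simp [pathEdges]
    · exact ⟨s(u, x), by simp [pathEdges]⟩

/-- Functions respecting a relation are functions on the quotient. -/
def respectEquiv {α β : Type*} (r : α → α → Prop) :
    {c : α → β // ∀ a b, r a b → c a = c b} ≃ (Quotient (Relation.EqvGen.setoid r) → β) where
  toFun c := Quotient.lift c.1 (fun a b (h : Relation.EqvGen r a b) => by
    induction h with
    | rel a b h => exact c.2 a b h
    | refl a => rfl
    | symm a b _ ih => exact ih.symm
    | trans a b d _ _ ih1 ih2 => exact ih1.trans ih2)
  invFun f := ⟨fun a => f (Quotient.mk _ a), fun a b h =>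
    congrArg f (Quotient.sound (Relation.EqvGen.rel a b h))⟩
  left_inv c := rfl
  right_inv f := by
    funext q
    induction q using Quotient.inductionOn
    rfl

theorem unsat_card {V : Type*} [Fintype V] (G : SimpleGraph V) (X : Finset (Sym2 V)) :
    Nat.card {c : G.edgeSet → Fin 2 // ∀ e ∈ X, ¬ satisfiedBy G c e} =
      2 ^ Nat.card (Quotient (Relation.EqvGen.setoid (linkedBy G (↑X : Set (Sym2 V))))) := by
  classical
  have h := Nat.card_congr ((Equiv.subtypeEquivRight fun c => unsat_iff G (↑X) c).trans
    (respectEquiv (linkedBy G (↑X : Set (Sym2 V)))))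
  rw [Nat.card_fun] at h
  simpa using h

/-- if every pair of `S` is at distance exactly 2 in `G`, then the number
of 2-edge-colorings of `G` satisfying all pairs of `S` (connecting each by a rainbow
2-edge path) equals `Σ_{X ⊆ S} (−1)^{|X|} · 2^{|E/≈_X|}`. -/
theorem stmt_4 {V : Type*} [Fintype V] (G : SimpleGraph V) (S : Finset (Sym2 V))
    (hS : ∀ u v : V, s(u, v) ∈ S → G.dist u v = 2) :
    (Nat.card {c : G.edgeSet → Fin 2 // ∀ e ∈ S, satisfiedBy G c e} : ℤ) =
      ∑ X ∈ S.powerset, (-1 : ℤ) ^ X.card *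
        2 ^ Nat.card (Quotient (Relation.EqvGen.setoid
          (linkedBy G (↑X : Set (Sym2 V))))) := by
  classical
  let U : Sym2 V → Finset (G.edgeSet → Fin 2) :=
    fun e => Finset.univ.filter (fun c => ¬ satisfiedBy G c e)
  have key := Finset.inclusion_exclusion_card_inf_compl S U
  have hL : Nat.card {c : G.edgeSet → Fin 2 // ∀ e ∈ S, satisfiedBy G c e} =
      (S.inf fun e => (U e)ᶜ).card := by
    rw [Nat.card_eq_fintype_card, Fintype.card_subtype]
    congr 1
    ext c
    simp [Finset.mem_inf, U]
  rw [hL, key]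
  refine Finset.sum_congr rfl fun X _ => ?_
  congr 1
  have hX : (X.inf U).card = Nat.card {c : G.edgeSet → Fin 2 // ∀ e ∈ X, ¬ satisfiedBy G c e} := by
    rw [Nat.card_eq_fintype_card, Fintype.card_subtype]
    congr 1
    ext c
    simp [Finset.mem_inf, U]
  rw [hX, unsat_card]
  push_cast
  rfl
end

section
/- For any n-vertex bipartite graph G with maximum degree Δ ≥ 1, the bipartite complement of G can be covered by O(Δ log n) bicliques (Jukna's theorem). -/
open Classical in
lemma aux_count {n k : ℕ} (u w : Fin n) (h : w ≠ u) :
    k * (Finset.univ.filter (fun f : Fin n → Fin k => f w = f u)).card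
      ≤ Fintype.card (Fin n → Fin k) := by
  have h1 : ((Finset.univ : Finset (Fin k)) ×ˢ
      (Finset.univ.filter (fun f : Fin n → Fin k => f w = f u))).card
      ≤ (Finset.univ : Finset (Fin n → Fin k)).card := by
    apply Finset.card_le_card_of_injOn (fun p => Function.update p.2 u p.1)
    · intro p _
      simp
    · rintro ⟨c, f⟩ hf ⟨d, g⟩ hg hfg
      simp only [Finset.coe_product, Set.mem_prod, Finset.mem_coe, Finset.mem_filter,
        Finset.mem_univ, true_and] at hf hg hfg
      have key : ∀ x, Function.update f u c x = Function.update g u d x := fun x => by rw [hfg]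
      have hc : c = d := by simpa using key u
      have hx : ∀ x, x ≠ u → f x = g x := fun x hx => by
        simpa [Function.update_of_ne hx] using key x
      have hfg' : f = g := by
        funext x
        by_cases hxu : x = u
        · rw [hxu, ← hf, ← hg, hx w h]
        · exact hx x hxu
      rw [hc, hfg']
  rw [Finset.card_product] at h1
  simpa using h1

open Classical in
lemma aux_bad {n₁ n₂ Δ : ℕ} (Adj : Fin n₁ → Fin n₂ → Prop) (hΔ : 1 ≤ Δ)
    (hd : ∀ v, Nat.card {u // Adj u v} ≤ Δ) (u : Fin n₁) (v : Fin n₂) (huv : ¬ Adj u v) :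
    2 * (Finset.univ.filter
      (fun f : Fin n₁ → Fin (2 * Δ) => ∃ w, Adj w v ∧ f w = f u)).card
      ≤ Fintype.card (Fin n₁ → Fin (2 * Δ)) := by
  set N := Fintype.card (Fin n₁ → Fin (2 * Δ)) with hN
  have hcard : (Finset.univ.filter (fun w => Adj w v)).card ≤ Δ := by
    have := hd v
    rwa [Nat.card_eq_fintype_card, Fintype.card_subtype] at this
  have hsub : (Finset.univ.filter
      (fun f : Fin n₁ → Fin (2 * Δ) => ∃ w, Adj w v ∧ f w = f u)) ⊆
      (Finset.univ.filter (fun w => Adj w v)).biUnion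
        (fun w => Finset.univ.filter (fun f : Fin n₁ → Fin (2 * Δ) => f w = f u)) := by
    intro f hf
    simpa using hf
  have h1 := (Finset.card_le_card hsub).trans Finset.card_biUnion_le
  have h2 : 2 * Δ * ∑ w ∈ Finset.univ.filter (fun w => Adj w v),
      (Finset.univ.filter (fun f : Fin n₁ → Fin (2 * Δ) => f w = f u)).card ≤ Δ * N := by
    rw [Finset.mul_sum]
    calc _ ≤ ∑ w ∈ Finset.univ.filter (fun w => Adj w v), N := by
          apply Finset.sum_le_sum
          intro w hw
          apply aux_count
          rintro rfl
          exact huv (by simpa using hw)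
      _ ≤ Δ * N := by
          rw [Finset.sum_const, smul_eq_mul]
          exact Nat.mul_le_mul_right _ hcard
  have h3 := (Nat.mul_le_mul_left (2 * Δ) h1).trans h2
  refine le_of_mul_le_mul_left (a := Δ) ?_ hΔ
  calc _ = 2 * Δ * _ := by rw [← mul_assoc, mul_comm Δ 2]
    _ ≤ _ := h3

open Classical in
lemma aux_step {n₁ n₂ Δ : ℕ} (Adj : Fin n₁ → Fin n₂ → Prop) (hΔ : 1 ≤ Δ)
    (hd : ∀ v, Nat.card {u // Adj u v} ≤ Δ) (S : Finset (Fin n₁ × Fin n₂))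
    (hS : ∀ p ∈ S, ¬ Adj p.1 p.2) :
    ∃ f : Fin n₁ → Fin (2 * Δ),
      2 * (S.filter (fun p => ∃ w, Adj w p.2 ∧ f w = f p.1)).card ≤ S.card := by
  by_contra! hcon
  have : Nonempty (Fin (2 * Δ)) := ⟨⟨0, by omega⟩⟩
  have h1 : ∑ _f : Fin n₁ → Fin (2 * Δ), S.card <
      ∑ f : Fin n₁ → Fin (2 * Δ),
        2 * (S.filter (fun p => ∃ w, Adj w p.2 ∧ f w = f p.1)).card :=
    Finset.sum_lt_sum_of_nonempty Finset.univ_nonempty (fun f _ => hcon f)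
  rw [← Finset.mul_sum] at h1
  have h2 : ∑ f : Fin n₁ → Fin (2 * Δ),
        (S.filter (fun p => ∃ w, Adj w p.2 ∧ f w = f p.1)).card =
      ∑ p ∈ S, (Finset.univ.filter
        (fun f : Fin n₁ → Fin (2 * Δ) => ∃ w, Adj w p.2 ∧ f w = f p.1)).card := by
    simp only [Finset.card_filter]
    exact Finset.sum_comm
  rw [h2, Finset.mul_sum] at h1
  have h3 := Finset.sum_le_sum (fun p hp => aux_bad Adj hΔ hd p.1 p.2 (hS p hp))
  have h4 := h1.trans_le h3
  simp only [Finset.sum_const, smul_eq_mul, Finset.card_univ] at h4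
  rw [mul_comm] at h4
  exact lt_irrefl _ h4

lemma aux_ind {n₁ n₂ Δ : ℕ} (Adj : Fin n₁ → Fin n₂ → Prop) (hΔ : 1 ≤ Δ)
    (hd : ∀ v, Nat.card {u // Adj u v} ≤ Δ) (t : ℕ) :
    ∀ S : Finset (Fin n₁ × Fin n₂), (∀ p ∈ S, ¬ Adj p.1 p.2) → S.card < 2 ^ t →
    ∃ F : Fin t → Fin n₁ → Fin (2 * Δ),
      ∀ p ∈ S, ∃ j, ∀ w, Adj w p.2 → F j w ≠ F j p.1 := by
  classical
  induction t with
  | zero =>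
    intro S _ hc
    have : S = ∅ := by simpa using hc
    subst this
    exact ⟨fun j => j.elim0, by simp⟩
  | succ t ih =>
    intro S hS hc
    obtain ⟨f, hf⟩ := aux_step Adj hΔ hd S hS
    obtain ⟨F, hF⟩ := ih (S.filter (fun p => ∃ w, Adj w p.2 ∧ f w = f p.1))
      (fun p hp => hS p (Finset.mem_filter.1 hp).1) (by rw [pow_succ] at hc; omega)
    refine ⟨Fin.cons f F, fun p hp => ?_⟩
    by_cases hb : ∃ w, Adj w p.2 ∧ f w = f p.1
    · obtain ⟨j, hj⟩ := hF p (Finset.mem_filter.2 ⟨hp, hb⟩)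
      exact ⟨j.succ, by simpa using hj⟩
    · push Not at hb
      exact ⟨0, by simpa using hb⟩

/-- Jukna: there is a universal constant `C` such that for every
`n`-vertex bipartite graph `G` (with parts of sizes `n₁`, `n₂`, `n = n₁ + n₂`) of
maximum degree at most `Δ ≥ 1`, the bipartite complement of `G` can be covered by
at most `C·Δ·log n` bicliques. -/
theorem stmt_13 :
    ∃ C : ℝ, 0 < C ∧
      ∀ (n₁ n₂ Δ : ℕ), 1 ≤ Δ → 2 ≤ n₁ + n₂ →
        ∀ Adj : Fin n₁ → Fin n₂ → Prop,
          (∀ u, Nat.card {v // Adj u v} ≤ Δ) →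
          (∀ v, Nat.card {u // Adj u v} ≤ Δ) →
          ∃ (q : ℕ) (A : Fin q → Finset (Fin n₁)) (B : Fin q → Finset (Fin n₂)),
            (q : ℝ) ≤ C * Δ * Real.log (n₁ + n₂) ∧
            (∀ i, ∀ u ∈ A i, ∀ v ∈ B i, ¬ Adj u v) ∧
            (∀ u v, ¬ Adj u v → ∃ i, u ∈ A i ∧ v ∈ B i) := by
  classical
  refine ⟨16, by norm_num, ?_⟩
  intro n₁ n₂ Δ hΔ hn Adj _ hd
  set n := n₁ + n₂ with hndef
  set L := Nat.log 2 n with hL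
  have hL1 : 1 ≤ L := Nat.log_pos (by norm_num) hn
  have hlt : n < 2 ^ (L + 1) := Nat.lt_pow_succ_log_self (by norm_num) n
  have hle : 2 ^ L ≤ n := Nat.pow_log_le_self 2 (by omega)
  obtain ⟨F, hF⟩ := aux_ind Adj hΔ hd (2 * (L + 1))
    (Finset.univ.filter (fun p => ¬ Adj p.1 p.2)) (by simp) (by
      calc _ ≤ (Finset.univ : Finset (Fin n₁ × Fin n₂)).card := Finset.card_filter_le _ _
        _ = n₁ * n₂ := by simp
        _ ≤ n * n := Nat.mul_le_mul (by omega) (by omega)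
        _ < 2 ^ (L + 1) * 2 ^ (L + 1) := Nat.mul_lt_mul'' hlt hlt
        _ = 2 ^ (2 * (L + 1)) := by rw [← pow_add, two_mul])
  let e := (finProdFinEquiv : Fin (2 * (L + 1)) × Fin (2 * Δ) ≃ _)
  refine ⟨2 * (L + 1) * (2 * Δ),
    fun i => Finset.univ.filter (fun u => F (e.symm i).1 u = (e.symm i).2),
    fun i => Finset.univ.filter (fun v => ∀ w, Adj w v → F (e.symm i).1 w ≠ (e.symm i).2),
    ?_, ?_, ?_⟩
  · have h1 : (L : ℝ) * Real.log 2 ≤ Real.log (n₁ + n₂) := by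
      rw [← Real.log_pow]
      apply Real.log_le_log (by positivity)
      exact_mod_cast hle
    have h2 : (1 / 2 : ℝ) ≤ Real.log 2 := by linarith [Real.log_two_gt_d9]
    have h3 : (1 : ℝ) ≤ L := by exact_mod_cast hL1
    have h4 : (L : ℝ) + 1 ≤ 4 * Real.log (n₁ + n₂) := by nlinarith
    push_cast
    have h5 : (0 : ℝ) ≤ Δ := by positivity
    nlinarith [mul_le_mul_of_nonneg_left h4 h5]
  · intro i u hu v hv hadj
    simp only [Finset.mem_filter, Finset.mem_univ, true_and] at hu hv
    exact hv u hadj hu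
  · intro u v huv
    obtain ⟨j, hj⟩ := hF (u, v) (by simpa using huv)
    refine ⟨e (j, F j u), ?_, ?_⟩
    · simp
    · simpa using hj
end

section
/- Let G be an n-vertex graph with a proper vertex p-coloring, with maximum degree Δ₁ = max(Δ(G), 1). Then the edges of the complement graph Ḡ can be covered by O(p²·Δ₁·log n) bicliques of Ḡ, such that every edge of G shares at most one vertex with each biclique (i.e., no biclique of the cover contains both endpoints of any edge of G). -/
open Classical in
lemma card_eq_mul_le (n k : ℕ) (u w : Fin n) (h : u ≠ w) :
    (Finset.univ.filter fun f : Fin n → Fin k => f u = f w).card * k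
      ≤ Fintype.card (Fin n → Fin k) := by
  have key : ((Finset.univ.filter fun f : Fin n → Fin k => f u = f w) ×ˢ
      (Finset.univ : Finset (Fin k))).card ≤ (Finset.univ : Finset (Fin n → Fin k)).card := by
    apply Finset.card_le_card_of_injOn (fun x => Function.update x.1 u x.2)
    · intro x _
      simp
    · rintro ⟨f, i⟩ hf ⟨g, j⟩ hg hfg
      simp only [Finset.coe_product, Set.mem_prod, Finset.mem_coe, Finset.mem_filter,
        Finset.mem_univ, true_and, and_true] at hf hg
      simp only at hfg
      have e : ∀ x, x ≠ u → f x = g x := by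
        intro x hx
        have := congrFun hfg x
        simpa [Function.update_of_ne hx] using this
      have e2 : i = j := by simpa using congrFun hfg u
      refine Prod.ext ?_ e2
      funext x
      by_cases hx : x = u
      · subst hx
        show f x = g x
        rw [hf, hg, e w h.symm]
      · exact e x hx
  simpa [Finset.card_product] using key

open Classical in
lemma half_bad (n k : ℕ) (hk : 0 < k) (u : Fin n) (N : Finset (Fin n)) (hu : u ∉ N)
    (hN : 2 * N.card ≤ k) :
    2 * (Finset.univ.filter fun f : Fin n → Fin k => ∃ w ∈ N, f u = f w).card
      ≤ Fintype.card (Fin n → Fin k) := by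
  have h1 : (Finset.univ.filter fun f : Fin n → Fin k => ∃ w ∈ N, f u = f w).card
      ≤ ∑ w ∈ N, (Finset.univ.filter fun f : Fin n → Fin k => f u = f w).card := by
    refine le_trans (Finset.card_le_card ?_) Finset.card_biUnion_le
    intro f hf
    simpa using hf
  have h2 : (∑ w ∈ N, (Finset.univ.filter fun f : Fin n → Fin k => f u = f w).card) * k
      ≤ N.card * Fintype.card (Fin n → Fin k) := by
    rw [Finset.sum_mul, ← smul_eq_mul]
    apply Finset.sum_le_card_nsmul
    intro w hw
    apply card_eq_mul_le
    rintro rfl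
    exact hu hw
  have h3 := Nat.mul_le_mul_right k h1
  have h4 := Nat.mul_le_mul_right (Fintype.card (Fin n → Fin k)) hN
  refine Nat.le_of_mul_le_mul_left ?_ hk
  nlinarith

open Classical in
lemma greedy {P Ω : Type} [Fintype Ω] [Nonempty Ω] (bad : P → Ω → Prop) (t : ℕ) :
    ∀ S : Finset P, S.card < 2 ^ t →
      (∀ x ∈ S, 2 * (Finset.univ.filter fun f => bad x f).card ≤ Fintype.card Ω) →
      ∃ F : Fin t → Ω, ∀ x ∈ S, ∃ i, ¬ bad x (F i) := by
  induction t with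
  | zero =>
    intro S hS _
    have : S = ∅ := by simpa using hS
    subst this
    exact ⟨fun _ => Classical.arbitrary Ω, by simp⟩
  | succ t ih =>
    intro S hS hb
    obtain ⟨f, hf⟩ : ∃ f : Ω, 2 * (S.filter fun x => bad x f).card ≤ S.card := by
      by_contra! hcon
      have hs : ∑ x ∈ S, (Finset.univ.filter fun f => bad x f).card
          = ∑ f : Ω, (S.filter fun x => bad x f).card :=
        Finset.sum_card_bipartiteAbove_eq_sum_card_bipartiteBelow bad
      have h1 : ∑ x ∈ S, 2 * (Finset.univ.filter fun f => bad x f).card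
          ≤ S.card * Fintype.card Ω := by
        rw [← smul_eq_mul]
        exact Finset.sum_le_card_nsmul _ _ _ hb
      have h2 : ∑ _f : Ω, S.card < ∑ f : Ω, 2 * (S.filter fun x => bad x f).card :=
        Finset.sum_lt_sum_of_nonempty Finset.univ_nonempty (fun f _ => hcon f)
      rw [← Finset.mul_sum] at h1 h2
      rw [hs] at h1
      simp only [Finset.sum_const, smul_eq_mul, Finset.card_univ] at h2
      nlinarith
    obtain ⟨F, hF⟩ := ih (S.filter fun x => bad x f) (by rw [pow_succ] at hS; omega)
      (fun x hx => hb x (Finset.mem_filter.1 hx).1)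
    refine ⟨Fin.cons f F, fun x hx => ?_⟩
    by_cases hx2 : bad x f
    · obtain ⟨i, hi⟩ := hF x (Finset.mem_filter.2 ⟨hx, hx2⟩)
      exact ⟨i.succ, by simpa using hi⟩
    · exact ⟨0, by simpa using hx2⟩

/-- there is a universal constant `C` such that for every `n`-vertex
graph `G` with a proper vertex `p`-coloring, with `Δ₁ = max(Δ(G), 1)`, the edges of
the complement graph can be covered by at most `C·p²·Δ₁·log n` bicliques of the
complement, in such a way that no biclique of the cover contains both endpoints of
any edge of `G`. -/
theorem stmt_14 :
    ∃ C : ℝ, 0 < C ∧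
      ∀ (n p : ℕ) (G : SimpleGraph (Fin n)), 2 ≤ n →
        ∀ col : Fin n → Fin p, (∀ a b, G.Adj a b → col a ≠ col b) →
          ∃ (q : ℕ) (A B : Fin q → Finset (Fin n)),
            (q : ℝ) ≤ C * (p : ℝ) ^ 2 *
              ((max (Finset.univ.sup fun x => Nat.card {y // G.Adj x y}) 1 : ℕ) : ℝ) *
              Real.log n ∧
            (∀ i, ∀ u ∈ A i, ∀ v ∈ B i, u ≠ v ∧ ¬ G.Adj u v) ∧
            (∀ u v : Fin n, u ≠ v → ¬ G.Adj u v →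
              ∃ i, (u ∈ A i ∧ v ∈ B i) ∨ (v ∈ A i ∧ u ∈ B i)) ∧
            (∀ i, ∀ a b : Fin n, G.Adj a b →
              ¬ ((a ∈ A i ∨ a ∈ B i) ∧ (b ∈ A i ∨ b ∈ B i))) := by
  classical
  refine ⟨32, by norm_num, ?_⟩
  intro n p G hn col hcol
  set D := max (Finset.univ.sup fun x => Nat.card {y // G.Adj x y}) 1 with hD
  have hD1 : 1 ≤ D := le_max_right _ _
  have hdeg : ∀ v, (Finset.univ.filter fun w => G.Adj v w).card ≤ D := by
    intro v
    refine le_trans ?_ (le_max_left _ _)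
    refine le_trans (le_of_eq ?_)
      (Finset.le_sup (f := fun x => Nat.card {y // G.Adj x y}) (Finset.mem_univ v))
    simp [Nat.card_eq_fintype_card, Fintype.card_subtype]
  obtain ⟨k, hk⟩ : ∃ k, k = 2 * (D + 1) := ⟨_, rfl⟩
  obtain ⟨t, ht⟩ : ∃ t, t = 2 * (Nat.log 2 n + 1) := ⟨_, rfl⟩
  have hk0 : 0 < k := by omega
  have : Nonempty (Fin n → Fin k) := ⟨fun _ => ⟨0, hk0⟩⟩
  obtain ⟨F, hF⟩ := greedy
    (fun (x : Fin n × Fin n) (f : Fin n → Fin k) =>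
      ∃ w ∈ insert x.2 (Finset.univ.filter fun w => G.Adj x.2 w), f x.1 = f w) t
    (Finset.univ.filter fun x : Fin n × Fin n => x.1 ≠ x.2 ∧ ¬ G.Adj x.1 x.2)
    (by
      refine lt_of_le_of_lt (Finset.card_filter_le _ _) ?_
      have h := Nat.lt_pow_succ_log_self (b := 2) (by norm_num) n
      have h2 : (2 : ℕ) ^ t = 2 ^ (Nat.log 2 n).succ * 2 ^ (Nat.log 2 n).succ := by
        rw [ht, ← pow_add]; congr 1; omega
      rw [h2]
      simp only [Finset.card_univ, Fintype.card_prod, Fintype.card_fin]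
      exact Nat.mul_lt_mul'' h h)
    (by
      rintro ⟨u, v⟩ hx
      simp only [Finset.mem_filter, Finset.mem_univ, true_and] at hx
      have hmain := half_bad n k hk0 u (insert v (Finset.univ.filter fun w => G.Adj v w)) ?_ ?_
      · convert hmain
      · simp only [Finset.mem_insert, Finset.mem_filter, Finset.mem_univ, true_and, not_or]
        exact ⟨hx.1, fun h => hx.2 h.symm⟩
      · have h1 := Finset.card_insert_le v (Finset.univ.filter fun w => G.Adj v w)
        have h2 := hdeg v
        show 2 * (insert v (Finset.univ.filter fun w => G.Adj v w)).card ≤ k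
        omega)
  let e := Fintype.equivFin (Fin p × Fin p × Fin t × Fin k)
  let A : Fin p × Fin p × Fin t × Fin k → Finset (Fin n) := fun x =>
    Finset.univ.filter fun u => col u = x.1 ∧ F x.2.2.1 u = x.2.2.2
  let B : Fin p × Fin p × Fin t × Fin k → Finset (Fin n) := fun x =>
    Finset.univ.filter fun v => col v = x.2.1 ∧
      ∀ w, (w = v ∨ G.Adj v w) → F x.2.2.1 w = x.2.2.2 → col w ≠ x.1
  have hA : ∀ x u, u ∈ A x ↔ col u = x.1 ∧ F x.2.2.1 u = x.2.2.2 := by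
    intro x u; simp [A]
  have hB : ∀ x v, v ∈ B x ↔ col v = x.2.1 ∧
      ∀ w, (w = v ∨ G.Adj v w) → F x.2.2.1 w = x.2.2.2 → col w ≠ x.1 := by
    intro x v; simp only [B, Finset.mem_filter, Finset.mem_univ, true_and]
  have hAB : ∀ x u v, u ∈ A x → v ∈ B x → u ≠ v ∧ ¬ G.Adj u v := by
    intro x u v hu hv
    rw [hA] at hu
    rw [hB] at hv
    exact ⟨fun h => hv.2 u (Or.inl h) hu.2 hu.1,
      fun h => hv.2 u (Or.inr h.symm) hu.2 hu.1⟩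
  refine ⟨_, fun i => A (e.symm i), fun i => B (e.symm i), ?_, ?_, ?_, ?_⟩
  · simp only [Fintype.card_prod, Fintype.card_fin]
    have hl2 : (1 / 2 : ℝ) ≤ Real.log 2 := by linarith [Real.log_two_gt_d9]
    have hln : Real.log 2 ≤ Real.log n :=
      Real.log_le_log (by norm_num) (by exact_mod_cast hn)
    have hL : (Nat.log 2 n : ℝ) * Real.log 2 ≤ Real.log n := by
      rw [← Real.log_pow]
      apply Real.log_le_log (by positivity)
      exact_mod_cast Nat.pow_log_le_self 2 (by omega)
    have hL0 : (0 : ℝ) ≤ (Nat.log 2 n : ℝ) := Nat.cast_nonneg _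
    have htn : (t : ℝ) ≤ 8 * Real.log n := by
      rw [ht]; push_cast; nlinarith
    have hkD : (k : ℝ) ≤ 4 * D := by
      have : k ≤ 4 * D := by omega
      exact_mod_cast this
    have hmul : (t : ℝ) * k ≤ (8 * Real.log n) * (4 * D) :=
      mul_le_mul htn hkD (Nat.cast_nonneg _) (by linarith)
    have := mul_le_mul_of_nonneg_left hmul (sq_nonneg (p : ℝ))
    push_cast
    linarith
  · intro i u hu v hv
    exact hAB _ u v hu hv
  · intro u v huv hadj
    obtain ⟨i, hi⟩ := hF (u, v) (by simp [huv, hadj])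
    refine ⟨e (col u, col v, i, F i u), Or.inl ⟨?_, ?_⟩⟩
    · simp only [Equiv.symm_apply_apply]
      rw [hA]; exact ⟨rfl, rfl⟩
    · simp only [Equiv.symm_apply_apply]
      rw [hB]
      refine ⟨rfl, fun w hw hFw _ => hi ⟨w, ?_, hFw.symm⟩⟩
      simpa using hw
  · rintro i a b hab ⟨ha | ha, hb | hb⟩
    · exact hcol a b hab (((hA _ _).1 ha).1.trans ((hA _ _).1 hb).1.symm)
    · exact (hAB _ _ _ ha hb).2 hab
    · exact (hAB _ _ _ hb ha).2 hab.symm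
    · exact hcol a b hab (((hB _ _).1 ha).1.trans ((hB _ _).1 hb).1.symm)
end
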